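/- arXiv:1901.07834 — 2 statements merged into one kernel-verified Lean document; each statement's English description precedes it below -/
import Mathlib

section
/- Let n ≥ 1, let A be an n×n real matrix with A ≠ I whose complex eigenvalues all lie in ℂ∖(−∞,0], and let ‖·‖ be a consistent matrix norm. Let l < r be real numbers, set a = (tanh(sinh(l))+1)/2 and b = (tanh(sinh(r))+1)/2, and suppose a ≤ 1/(2‖A−I‖) and b ≥ 2‖A^{-1}‖/(2‖A^{-1}‖+1). Then ‖ (A−I)·∫_{-∞}^{∞} F_DE(x) dx − (A−I)·∫_l^r F_DE(x) dx ‖ ≤ (3a/2)·‖A−I‖ + (−log(b) + (1−b)/(2b))·‖A−I‖·‖A^{-1}‖, where both improper integrals exist. -/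
open MeasureTheory

/-- Entrywise integral of a matrix-valued function over an interval. -/
noncomputable def entryIntegral {n : ℕ} (f : ℝ → Matrix (Fin n) (Fin n) ℝ) (a b : ℝ) :
    Matrix (Fin n) (Fin n) ℝ :=
  Matrix.of fun i j => ∫ t in a..b, f t i j

/-- Entrywise integral of a matrix-valued function over the whole real line. -/
noncomputable def lineIntegral {n : ℕ} (f : ℝ → Matrix (Fin n) (Fin n) ℝ) :
    Matrix (Fin n) (Fin n) ℝ :=
  Matrix.of fun i j => ∫ x : ℝ, f x i j

/-- The integrand of the double exponential transformation. -/
noncomputable def FDE {n : ℕ} (A : Matrix (Fin n) (Fin n) ℝ) (x : ℝ) :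
    Matrix (Fin n) (Fin n) ℝ :=
  (Real.cosh x * (1 / Real.cosh (Real.sinh x)) ^ 2) •
    ((1 + Real.tanh (Real.sinh x)) • (A - 1) + (2 : Matrix (Fin n) (Fin n) ℝ))⁻¹

/-- The change of variables `t = (tanh (sinh x) + 1) / 2` of the double exponential formula. -/
noncomputable def deVar (x : ℝ) : ℝ := (Real.tanh (Real.sinh x) + 1) / 2

/-- The derivative of `deVar`. -/
noncomputable def deWeight (x : ℝ) : ℝ := Real.cosh x * (1 / Real.cosh (Real.sinh x)) ^ 2 / 2

lemma deVar_pos (x : ℝ) : 0 < deVar x := by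
  have := Real.neg_one_lt_tanh (Real.sinh x)
  unfold deVar; linarith

lemma deVar_lt_one (x : ℝ) : deVar x < 1 := by
  have := Real.tanh_lt_one (Real.sinh x)
  unfold deVar; linarith

lemma deWeight_pos (x : ℝ) : 0 < deWeight x := by
  have := Real.cosh_pos x
  have := Real.cosh_pos (Real.sinh x)
  unfold deWeight; positivity

lemma continuous_deWeight : Continuous deWeight := by
  unfold deWeight
  have h : ∀ x : ℝ, Real.cosh (Real.sinh x) ≠ 0 := fun x => (Real.cosh_pos _).ne'
  have h1 : Continuous fun x : ℝ => Real.cosh (Real.sinh x) :=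
    Real.continuous_cosh.comp Real.continuous_sinh
  exact (Real.continuous_cosh.mul ((continuous_const.div h1 h).pow 2)).div_const 2

lemma hasDerivAt_deVar (x : ℝ) : HasDerivAt deVar (deWeight x) x := by
  have hc := (Real.cosh_pos (Real.sinh x)).ne'
  have h1 := (((Real.hasDerivAt_sinh x).sinh.div (Real.hasDerivAt_sinh x).cosh hc).add_const
    (1 : ℝ)).div_const 2
  have h2 : deVar = fun y => (Real.sinh (Real.sinh y) / Real.cosh (Real.sinh y) + 1) / 2 := by
    funext y
    rw [deVar, Real.tanh_eq_sinh_div_cosh]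
  rw [h2]
  refine h1.congr_deriv ?_
  have h3 := Real.cosh_sq (Real.sinh x)
  unfold deWeight
  field_simp
  linear_combination h3

lemma continuous_deVar : Continuous deVar :=
  continuous_iff_continuousAt.2 fun x => (hasDerivAt_deVar x).continuousAt

lemma strictMono_deVar : StrictMono deVar :=
  strictMono_of_hasDerivAt_pos hasDerivAt_deVar deWeight_pos

lemma deVar_eq (x : ℝ) : deVar x = (1 + Real.exp (-(2 * Real.sinh x)))⁻¹ := by
  have h1 := Real.exp_pos (Real.sinh x)
  have h2 : Real.exp (-(2 * Real.sinh x)) = (Real.exp (Real.sinh x))⁻¹ ^ 2 := by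
    rw [← Real.exp_neg, ← Real.exp_nat_mul]; congr 1; push_cast; ring
  rw [deVar, Real.tanh_eq, h2, Real.exp_neg]
  field_simp
  ring

lemma tendsto_deVar_atTop : Filter.Tendsto deVar Filter.atTop (nhds 1) := by
  have h : Filter.Tendsto Real.sinh Filter.atTop Filter.atTop :=
    Real.sinhOrderIso.tendsto_atTop
  have h1 := Real.tendsto_exp_neg_atTop_nhds_zero.comp (h.const_mul_atTop (two_pos (α := ℝ)))
  have h2 := (h1.const_add 1).inv₀ (by norm_num)
  simp only [add_zero, inv_one] at h2
  exact h2.congr fun x => (deVar_eq x).symm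

lemma tendsto_deVar_atBot : Filter.Tendsto deVar Filter.atBot (nhds 0) := by
  have h : Filter.Tendsto Real.sinh Filter.atBot Filter.atBot :=
    Real.sinhOrderIso.tendsto_atBot
  have h1 : Filter.Tendsto (fun x => -(2 * Real.sinh x)) Filter.atBot Filter.atTop :=
    Filter.tendsto_neg_atBot_atTop.comp (h.const_mul_atBot (two_pos (α := ℝ)))
  have h2 := (Filter.tendsto_atTop_add_const_left _ (1 : ℝ)
    (Real.tendsto_exp_atTop.comp h1)).inv_tendsto_atTop
  exact h2.congr fun x => (deVar_eq x).symm

lemma integrable_deWeight : Integrable deWeight := by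
  refine integrable_of_intervalIntegral_norm_bounded (l := Filter.atTop) (a := fun y : ℝ => -y)
    (b := fun y : ℝ => y) 1
    (fun i => (continuous_deWeight.integrableOn_Icc).mono_set Set.Ioc_subset_Icc_self)
    Filter.tendsto_neg_atTop_atBot Filter.tendsto_id (Filter.Eventually.of_forall fun y => ?_)
  have h1 : ∀ x, ‖deWeight x‖ = deWeight x := fun x => Real.norm_of_nonneg (deWeight_pos x).le
  simp only [h1]
  rw [intervalIntegral.integral_eq_sub_of_hasDerivAt (fun x _ => hasDerivAt_deVar x)
    (continuous_deWeight.intervalIntegrable _ _)]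
  linarith [deVar_lt_one y, deVar_pos (-y)]

/-- A function continuous on `[0, 1]` becomes integrable after the double exponential
substitution. -/
lemma integrable_deWeight_mul_comp {g : ℝ → ℝ} (hg : ContinuousOn g (Set.Icc 0 1)) :
    Integrable fun x => deWeight x * g (deVar x) := by
  obtain ⟨C, hC⟩ := isCompact_Icc.exists_bound_of_continuousOn hg
  have hmem : ∀ x, deVar x ∈ Set.Icc (0 : ℝ) 1 := fun x => ⟨(deVar_pos x).le, (deVar_lt_one x).le⟩
  exact integrable_deWeight.mul_bdd
    (hg.comp_continuous continuous_deVar hmem).aestronglyMeasurable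
    (Filter.Eventually.of_forall fun x => hC _ (hmem x))

lemma hasDerivAt_comp_deVar {G g : ℝ → ℝ} {x : ℝ} (hG : HasDerivAt G (g (deVar x)) (deVar x)) :
    HasDerivAt (fun y => G (deVar y)) (deWeight x * g (deVar x)) x := by
  rw [mul_comm]
  exact hG.comp x (hasDerivAt_deVar x)

lemma setIntegral_Iic_le_sub {G g h : ℝ → ℝ} {l : ℝ} (hh : Integrable h)
    (hG : ∀ t, HasDerivAt G (g t) t) (hg : Continuous g)
    (hle : ∀ x ≤ l, h x ≤ deWeight x * g (deVar x)) :
    ∫ x in Set.Iic l, h x ≤ G (deVar l) - G 0 := by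
  have hint : IntegrableOn (fun x => deWeight x * g (deVar x)) (Set.Iic l) :=
    (integrable_deWeight_mul_comp hg.continuousOn).integrableOn
  rw [← integral_Iic_of_hasDerivAt_of_tendsto' (fun x _ => hasDerivAt_comp_deVar (hG _)) hint
    ((hG 0).continuousAt.tendsto.comp tendsto_deVar_atBot)]
  exact setIntegral_mono_on hh.integrableOn hint measurableSet_Iic hle

lemma setIntegral_Ioi_le_sub {G g h : ℝ → ℝ} {r : ℝ} (hh : Integrable h)
    (hG : ∀ t, 0 < t → HasDerivAt G (g t) t) (hg : ∀ t, 0 < t → t ≤ 1 → 0 ≤ g t)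
    (hle : ∀ x, r < x → h x ≤ deWeight x * g (deVar x)) :
    ∫ x in Set.Ioi r, h x ≤ G 1 - G (deVar r) := by
  have hd : ∀ x ∈ Set.Ici r, HasDerivAt (fun y => G (deVar y)) (deWeight x * g (deVar x)) x :=
    fun x _ => hasDerivAt_comp_deVar (hG _ (deVar_pos x))
  have hn : ∀ x ∈ Set.Ioi r, 0 ≤ deWeight x * g (deVar x) := fun x _ =>
    mul_nonneg (deWeight_pos x).le (hg _ (deVar_pos x) (deVar_lt_one x).le)
  have ht := (hG 1 one_pos).continuousAt.tendsto.comp tendsto_deVar_atTop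
  rw [← integral_Ioi_of_hasDerivAt_of_nonneg' hd hn ht]
  exact setIntegral_mono_on hh.integrableOn (integrableOn_Ioi_deriv_of_nonneg' hd hn ht)
    measurableSet_Ioi hle

/-- A sublinear, absolutely homogeneous function attains its value at each point through a
dominated linear functional. -/
lemma exists_linearMap_eq_and_le {E : Type*} [AddCommGroup E] [Module ℝ E] (N : E → ℝ)
    (hN_add : ∀ X Y, N (X + Y) ≤ N X + N Y) (hN_smul : ∀ (c : ℝ) (X), N (c • X) = |c| * N X)
    (X : E) : ∃ φ : E →ₗ[ℝ] ℝ, φ X = N X ∧ ∀ Y, φ Y ≤ N Y := by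
  have h0 : N 0 = 0 := by simpa using hN_smul 0 0
  have hnonneg : ∀ Y, 0 ≤ N Y := fun Y => by
    have h1 := hN_add Y ((-1 : ℝ) • Y)
    have h2 : Y + (-1 : ℝ) • Y = 0 := by simp
    rw [h2, h0, hN_smul] at h1
    norm_num at h1
    linarith
  by_cases hX : X = 0
  · exact ⟨0, by simp [hX, h0], fun Y => by simpa using hnonneg Y⟩
  let f : E →ₗ.[ℝ] ℝ := LinearPMap.mkSpanSingleton X (N X) hX
  obtain ⟨φ, hφ, hle⟩ := exists_extension_of_le_sublinear f N
    (fun c hc Y => by rw [hN_smul, abs_of_pos hc]) hN_add (by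
      rintro ⟨y, hy⟩
      obtain ⟨c, rfl⟩ := Submodule.mem_span_singleton.1 hy
      have : f ⟨c • X, hy⟩ = c • N X := LinearPMap.mkSpanSingleton'_apply _ _ _ _ _
      rw [this, hN_smul, smul_eq_mul]
      exact mul_le_mul_of_nonneg_right (le_abs_self c) (hnonneg X))
  refine ⟨φ, ?_, hle⟩
  rw [hφ ⟨X, Submodule.mem_span_singleton_self X⟩]
  exact LinearPMap.mkSpanSingleton_apply ℝ ℝ hX (N X)

lemma exists_linearMap_eq_sum {n : ℕ} (ψ : Matrix (Fin n) (Fin n) ℝ →ₗ[ℝ] ℝ) :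
    ∃ c : Fin n → Fin n → ℝ, ∀ M, ψ M = ∑ i, ∑ j, M i j * c i j := by
  refine ⟨fun i j => ψ (Matrix.single i j 1), fun M => ?_⟩
  conv_lhs => rw [Matrix.matrix_eq_sum_single M]
  simp only [map_sum]
  refine Finset.sum_congr rfl fun i _ => Finset.sum_congr rfl fun j _ => ?_
  rw [← smul_eq_mul, ← map_smul, Matrix.smul_single, smul_eq_mul, mul_one]

section Linear

variable {n : ℕ} (ψ : Matrix (Fin n) (Fin n) ℝ →ₗ[ℝ] ℝ) {f : ℝ → Matrix (Fin n) (Fin n) ℝ}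

lemma integrable_linearMap_comp (hf : ∀ i j, Integrable fun x => f x i j) :
    Integrable fun x => ψ (f x) := by
  obtain ⟨c, hc⟩ := exists_linearMap_eq_sum ψ
  simp only [hc]
  exact integrable_finsetSum _ fun i _ => integrable_finsetSum _ fun j _ =>
    (hf i j).mul_const _

lemma linearMap_lineIntegral (hf : ∀ i j, Integrable fun x => f x i j) :
    ψ (lineIntegral f) = ∫ x, ψ (f x) := by
  obtain ⟨c, hc⟩ := exists_linearMap_eq_sum ψ
  simp only [hc]
  rw [integral_finsetSum _ fun i _ => integrable_finsetSum _ fun j _ => (hf i j).mul_const _]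
  refine Finset.sum_congr rfl fun i _ => ?_
  rw [integral_finsetSum _ fun j _ => (hf i j).mul_const _]
  refine Finset.sum_congr rfl fun j _ => ?_
  rw [integral_mul_const]
  rfl

lemma linearMap_entryIntegral (hf : ∀ i j, Integrable fun x => f x i j) (a b : ℝ) :
    ψ (entryIntegral f a b) = ∫ x in a..b, ψ (f x) := by
  obtain ⟨c, hc⟩ := exists_linearMap_eq_sum ψ
  simp only [hc]
  have hi : ∀ i j, Integrable fun x => f x i j * c i j := fun i j => (hf i j).mul_const _
  have hs : ∀ i, Integrable fun x => ∑ j, f x i j * c i j := fun i =>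
    integrable_finsetSum _ fun j _ => hi i j
  rw [intervalIntegral.integral_finsetSum fun i _ => (hs i).intervalIntegrable]
  refine Finset.sum_congr rfl fun i _ => ?_
  rw [intervalIntegral.integral_finsetSum fun j _ => (hi i j).intervalIntegrable]
  refine Finset.sum_congr rfl fun j _ => ?_
  rw [intervalIntegral.integral_mul_const]
  rfl

end Linear

lemma isUnit_det_of_forall_spectrum {n : ℕ} {A : Matrix (Fin n) (Fin n) ℝ}
    (hspec : ∀ μ ∈ spectrum ℂ (A.map fun x => (x : ℂ)), ¬(μ.im = 0 ∧ μ.re ≤ 0))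
    {t : ℝ} (ht : 0 ≤ t) (ht1 : t ≤ 1) : IsUnit (t • (A - 1) + 1).det := by
  rcases ht.eq_or_lt with rfl | ht0
  · simp
  rw [isUnit_iff_ne_zero]
  intro hdet
  set s : ℝ := -((1 - t) / t) with hs
  refine hspec (s : ℂ) ?_ ⟨by simp, ?_⟩
  · rw [spectrum.mem_iff, Matrix.isUnit_iff_isUnit_det, isUnit_iff_ne_zero, not_not]
    have h1 : t • (A - 1) + 1 = (-t) • (algebraMap ℝ (Matrix (Fin n) (Fin n) ℝ) s - A) := by
      have h : -t * s = 1 - t := by rw [hs]; field_simp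
      rw [Algebra.algebraMap_eq_smul_one, smul_sub (-t), smul_smul, h, sub_smul, smul_sub, neg_smul,
        one_smul]
      abel
    rw [h1, Matrix.det_smul] at hdet
    have h2 : (algebraMap ℝ (Matrix (Fin n) (Fin n) ℝ) s - A).det = 0 :=
      (mul_eq_zero.1 hdet).resolve_left (pow_ne_zero _ (neg_ne_zero.2 ht0.ne'))
    have h3 : algebraMap ℂ (Matrix (Fin n) (Fin n) ℂ) (s : ℂ) - A.map (fun x => (x : ℂ)) =
        Complex.ofRealHom.mapMatrix (algebraMap ℝ (Matrix (Fin n) (Fin n) ℝ) s - A) := by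
      ext i j
      by_cases hij : i = j <;> simp [Matrix.algebraMap_matrix_apply, hij]
    rw [h3, ← RingHom.map_det, h2, map_zero]
  · have : 0 ≤ (1 - t) / t := div_nonneg (by linarith) ht0.le
    simp [hs]; exact this

lemma FDE_eq {n : ℕ} {A : Matrix (Fin n) (Fin n) ℝ} (x : ℝ)
    (h : IsUnit (deVar x • (A - 1) + 1).det) :
    FDE A x = deWeight x • (deVar x • (A - 1) + 1)⁻¹ := by
  have h1 : (1 + Real.tanh (Real.sinh x)) • (A - 1) + (2 : Matrix (Fin n) (Fin n) ℝ) =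
      (2 : ℝ) • (deVar x • (A - 1) + 1) := by
    rw [smul_add, smul_smul, deVar]
    congr 1
    · congr 1; ring
    · rw [two_smul, one_add_one_eq_two]
  have h2 : ((2 : ℝ) • (deVar x • (A - 1) + 1))⁻¹ =
      (1 / 2 : ℝ) • (deVar x • (A - 1) + 1)⁻¹ := by
    apply Matrix.inv_eq_left_inv
    rw [Matrix.smul_mul, Matrix.mul_smul, smul_smul, Matrix.nonsing_inv_mul _ h]
    norm_num
  rw [FDE, h1, h2, smul_smul]
  congr 1
  unfold deWeight; ring

lemma continuousOn_inv_apply {n : ℕ} {M : ℝ → Matrix (Fin n) (Fin n) ℝ} {s : Set ℝ}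
    (hM : Continuous M) (h : ∀ t ∈ s, IsUnit (M t).det) (i j : Fin n) :
    ContinuousOn (fun t => (M t)⁻¹ i j) s := by
  simp only [Matrix.inv_def, Matrix.smul_apply, smul_eq_mul, Ring.inverse_eq_inv']
  exact (hM.matrix_det.continuousOn.inv₀ fun t ht => (h t ht).ne_zero).mul
    (hM.matrix_adjugate.matrix_elem i j).continuousOn

lemma integrable_FDE_apply {n : ℕ} {A : Matrix (Fin n) (Fin n) ℝ}
    (hunit : ∀ t : ℝ, 0 ≤ t → t ≤ 1 → IsUnit (t • (A - 1) + 1).det) (i j : Fin n) :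
    Integrable fun x => FDE A x i j := by
  have h := integrable_deWeight_mul_comp (continuousOn_inv_apply
    (M := fun t : ℝ => t • (A - 1) + 1) (by fun_prop) (fun t ht => hunit t ht.1 ht.2) i j)
  refine h.congr (Filter.Eventually.of_forall fun x => ?_)
  simp only [FDE_eq x (hunit _ (deVar_pos x).le (deVar_lt_one x).le), Matrix.smul_apply,
    smul_eq_mul]

section Consistent

variable {R : Type*} [Ring R] [Algebra ℝ R] {N : R → ℝ}

lemma norm_le_add_norm_sub (hN_add : ∀ X Y, N (X + Y) ≤ N X + N Y)
    (hN_smul : ∀ (c : ℝ) (X), N (c • X) = |c| * N X) (X Y : R) : N (X - Y) ≤ N X + N Y := by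
  have h := hN_add X ((-1 : ℝ) • Y)
  rw [hN_smul] at h
  simpa [sub_eq_add_neg] using h

lemma mul_norm_mul_inverse_le (hN_add : ∀ X Y, N (X + Y) ≤ N X + N Y)
    (hN_smul : ∀ (c : ℝ) (X), N (c • X) = |c| * N X) (hN_mul : ∀ X Y, N (X * Y) ≤ N X * N Y)
    {B S : R} {t : ℝ} (ht : 0 ≤ t) (hS : S * (t • B + 1) = 1) :
    N (B * S) * (1 - t * N B) ≤ N B := by
  have h1 : B * S = B - t • (B * S * B) := by
    have : B * S * (t • B + 1) = B := by rw [mul_assoc, hS, mul_one]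
    rw [mul_add, mul_one, mul_smul_comm] at this
    exact eq_sub_of_add_eq' this
  have h2 := norm_le_add_norm_sub hN_add hN_smul B (t • (B * S * B))
  rw [← h1, hN_smul, abs_of_nonneg ht] at h2
  have h3 := mul_le_mul_of_nonneg_left (hN_mul (B * S) B) ht
  linarith

lemma norm_inverse_mul_le (hN_add : ∀ X Y, N (X + Y) ≤ N X + N Y)
    (hN_smul : ∀ (c : ℝ) (X), N (c • X) = |c| * N X) (hN_mul : ∀ X Y, N (X * Y) ≤ N X * N Y)
    {A C S : R} {t : ℝ} (ht : 0 ≤ t) (ht1 : t ≤ 1) (hC : A * C = 1)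
    (hS : S * (t • (A - 1) + 1) = 1) :
    N S * (t - (1 - t) * N C) ≤ N C := by
  have h1 : t • S = C - (1 - t) • (S * C) := by
    have h : S * (t • (A - 1) + 1) * C = C := by rw [hS, one_mul]
    have h' : (t • (A - 1) + 1) * C = t • (1 : R) + (1 - t) • C := by
      rw [add_mul, smul_mul_assoc, sub_mul, hC, one_mul, smul_sub, sub_smul, one_smul]
      abel
    rw [mul_assoc, h', mul_add, mul_smul_comm, mul_one, mul_smul_comm] at h
    exact eq_sub_of_add_eq h
  have h2 := norm_le_add_norm_sub hN_add hN_smul C ((1 - t) • (S * C))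
  rw [← h1, hN_smul, hN_smul, abs_of_nonneg ht, abs_of_nonneg (sub_nonneg.2 ht1)] at h2
  have h3 := mul_le_mul_of_nonneg_left (hN_mul S C) (sub_nonneg.2 ht1)
  linarith

end Consistent

lemma le_mul_one_add_div {y β t a : ℝ} (hβ : 0 < β) (ht : 0 < t) (hta : t ≤ a)
    (ha : a * β ≤ 1 / 2) (h : y * (1 - t * β) ≤ β) : y ≤ β * (1 + t / a) := by
  have ha0 : 0 < a := ht.trans_le hta
  set u := t / a with hu
  have hu0 : 0 < u := div_pos ht ha0
  have hu1 : u ≤ 1 := (div_le_one ha0).2 hta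
  have htu : t * β ≤ u / 2 := by
    have : t * β = u * (a * β) := by rw [hu]; field_simp
    rw [this]; nlinarith
  have h1 : 1 ≤ (1 + u) * (1 - t * β) := by nlinarith
  have h2 : 0 < 1 - t * β := by linarith
  refine le_of_mul_le_mul_right (h.trans ?_) h2
  nlinarith

lemma le_mul_inv_add_div {y c t b : ℝ} (hc : 0 < c) (hb : 0 < b) (hbt : b ≤ t) (ht : t < 1)
    (hbc : 2 * c * (1 - b) ≤ b) (h : y * (t - (1 - t) * c) ≤ c) :
    y ≤ c * (t⁻¹ + (1 - t) / t ^ 3 * (b / (1 - b))) := by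
  have ht0 : 0 < t := hb.trans_le hbt
  have hb1 : 0 < 1 - b := by linarith
  set u := (1 - t) / t * (b / (1 - b)) with hu
  have ht1 : 0 < 1 - t := by linarith
  have hu0 : 0 < u := by positivity
  have hu1 : u ≤ 1 := by
    rw [hu, div_mul_div_comm, div_le_one (by positivity)]
    nlinarith
  have hs : (1 - t) * c ≤ t * (u / 2) := by
    have : t * (u / 2) = (1 - t) * (b / (1 - b) / 2) := by rw [hu]; field_simp
    rw [this]
    refine mul_le_mul_of_nonneg_left ?_ (by linarith)
    rw [div_div, le_div_iff₀ (by positivity)]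
    linarith
  have h2 : 0 < t - (1 - t) * c := by nlinarith
  have h1 : 1 ≤ t⁻¹ * (1 + u) * (t - (1 - t) * c) := by
    have h3 : t * (1 - u / 2) ≤ t - (1 - t) * c := by linarith
    have h4 : t⁻¹ * (1 + u) * (t * (1 - u / 2)) = (1 + u) * (1 - u / 2) := by field_simp
    have h5 := mul_le_mul_of_nonneg_left h3 (show 0 ≤ t⁻¹ * (1 + u) by positivity)
    nlinarith
  have h6 : y ≤ c * (t⁻¹ * (1 + u)) := by
    refine le_of_mul_le_mul_right (h.trans ?_) h2
    nlinarith
  refine h6.trans (mul_le_mul_of_nonneg_left ?_ hc.le)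
  have h7 : (1 - t) / t ^ 3 * (b / (1 - b)) = t⁻¹ * u * t⁻¹ := by rw [hu]; field_simp
  have h8 : 1 ≤ t⁻¹ := (one_le_inv₀ ht0).2 ht.le
  have h9 : 0 ≤ t⁻¹ * u := by positivity
  rw [h7]
  nlinarith

lemma hasDerivAt_log_sub_sq {t : ℝ} (ht : 0 < t) (k c : ℝ) :
    HasDerivAt (fun t => c * (Real.log t - (t⁻¹ - 1) ^ 2 / 2 * k))
      (c * (t⁻¹ + (1 - t) / t ^ 3 * k)) t := by
  have h := (((Real.hasDerivAt_log ht.ne').sub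
    (((((hasDerivAt_inv ht.ne').sub_const 1).pow 2).div_const 2).mul_const k)).const_mul c)
  refine h.congr_deriv ?_
  norm_num
  left
  field_simp
  ring

lemma hasDerivAt_mul_add_sq (β a t : ℝ) :
    HasDerivAt (fun t => β * (t + t ^ 2 / (2 * a))) (β * (1 + t / a)) t := by
  have h := (((hasDerivAt_id t).add (((hasDerivAt_id t).pow 2).div_const (2 * a))).const_mul β)
  refine h.congr_deriv ?_
  simp only [id]
  norm_num
  left
  rw [mul_div_mul_left _ _ two_ne_zero]

/-- Proposition 2.3: the interval truncation error bound for the DE formula. -/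
theorem stmt_5 {n : ℕ} (hn : 1 ≤ n) (A : Matrix (Fin n) (Fin n) ℝ) (hA : A ≠ 1)
    (hspec : ∀ μ ∈ spectrum ℂ (A.map fun x => (x : ℂ)), ¬(μ.im = 0 ∧ μ.re ≤ 0))
    (N : Matrix (Fin n) (Fin n) ℝ → ℝ)
    (hN_def : ∀ X, N X = 0 ↔ X = 0)
    (hN_add : ∀ X Y, N (X + Y) ≤ N X + N Y)
    (hN_smul : ∀ (c : ℝ) (X), N (c • X) = |c| * N X)
    (hN_mul : ∀ X Y, N (X * Y) ≤ N X * N Y)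
    (l r : ℝ) (hlr : l < r) (a b : ℝ)
    (hadef : a = (Real.tanh (Real.sinh l) + 1) / 2)
    (hbdef : b = (Real.tanh (Real.sinh r) + 1) / 2)
    (ha : a ≤ 1 / (2 * N (A - 1)))
    (hb : 2 * N A⁻¹ / (2 * N A⁻¹ + 1) ≤ b) :
    (∀ i j, Integrable (fun x => FDE A x i j)) ∧
      N ((A - 1) * lineIntegral (FDE A) - (A - 1) * entryIntegral (FDE A) l r) ≤
        3 * a / 2 * N (A - 1) +
          (-Real.log b + (1 - b) / (2 * b)) * (N (A - 1) * N A⁻¹) := by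
  have hunit : ∀ t : ℝ, 0 ≤ t → t ≤ 1 → IsUnit (t • (A - 1) + 1).det := fun t h0 h1 =>
    isUnit_det_of_forall_spectrum hspec h0 h1
  have hf := integrable_FDE_apply hunit
  refine ⟨hf, ?_⟩
  have : Nonempty (Fin n) := ⟨⟨0, hn⟩⟩
  have hAinv : A * A⁻¹ = 1 := Matrix.mul_nonsing_inv A (by simpa using hunit 1 zero_le_one le_rfl)
  have hpos : ∀ X, X ≠ 0 → 0 < N X := fun X hX => by
    have h1 := norm_le_add_norm_sub hN_add hN_smul X X
    rw [sub_self, (hN_def 0).2 rfl] at h1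
    exact lt_of_le_of_ne (by linarith) (fun h => hX ((hN_def X).1 h.symm))
  have hβ : 0 < N (A - 1) := hpos _ (sub_ne_zero.2 hA)
  have hc : 0 < N A⁻¹ := hpos _ fun h => by simp [h] at hAinv
  replace hadef : a = deVar l := hadef
  replace hbdef : b = deVar r := hbdef
  have ha0 : 0 < a := hadef ▸ deVar_pos l
  have hb0 : 0 < b := hbdef ▸ deVar_pos r
  have hb1 : b < 1 := hbdef ▸ deVar_lt_one r
  have haβ : a * N (A - 1) ≤ 1 / 2 := by
    rw [le_div_iff₀ (by positivity)] at ha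
    linarith
  have hbc : 2 * N A⁻¹ * (1 - b) ≤ b := by
    rw [div_le_iff₀ (by positivity)] at hb
    linarith
  obtain ⟨φ, hφ, hle⟩ := exists_linearMap_eq_and_le N hN_add hN_smul
    ((A - 1) * lineIntegral (FDE A) - (A - 1) * entryIntegral (FDE A) l r)
  let ψ : Matrix (Fin n) (Fin n) ℝ →ₗ[ℝ] ℝ := φ ∘ₗ LinearMap.mulLeft ℝ (A - 1)
  have hψ : ∀ M, ψ M = φ ((A - 1) * M) := fun M => rfl
  have hint := integrable_linearMap_comp ψ hf
  have hsplit : ∫ x, ψ (FDE A x) = (∫ x in Set.Iic l, ψ (FDE A x)) +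
      (∫ x in l..r, ψ (FDE A x)) + ∫ x in Set.Ioi r, ψ (FDE A x) := by
    rw [← intervalIntegral.integral_Iic_add_Ioi (b := r) hint.integrableOn hint.integrableOn,
      ← intervalIntegral.integral_Iic_sub_Iic (a := l) hint.integrableOn hint.integrableOn]
    ring
  rw [← hφ, map_sub, ← hψ, ← hψ, linearMap_lineIntegral ψ hf, linearMap_entryIntegral ψ hf, hsplit]
  have hpt : ∀ x, ψ (FDE A x) ≤
      deWeight x * N ((A - 1) * (deVar x • (A - 1) + 1)⁻¹) := fun x => by
    rw [FDE_eq x (hunit _ (deVar_pos x).le (deVar_lt_one x).le), map_smul, smul_eq_mul, hψ]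
    exact mul_le_mul_of_nonneg_left (hle _) (deWeight_pos x).le
  have hinv : ∀ x, (deVar x • (A - 1) + 1)⁻¹ * (deVar x • (A - 1) + 1) = 1 := fun x =>
    Matrix.nonsing_inv_mul _ (hunit _ (deVar_pos x).le (deVar_lt_one x).le)
  have hleft : ∫ x in Set.Iic l, ψ (FDE A x) ≤ 3 * a / 2 * N (A - 1) := by
    refine (setIntegral_Iic_le_sub hint (hasDerivAt_mul_add_sq (N (A - 1)) a) (by fun_prop)
      fun x hx => (hpt x).trans (mul_le_mul_of_nonneg_left ?_ (deWeight_pos x).le)).trans_eq ?_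
    · exact le_mul_one_add_div hβ (deVar_pos x) (hadef ▸ strictMono_deVar.monotone hx) haβ
        (mul_norm_mul_inverse_le hN_add hN_smul hN_mul (deVar_pos x).le (hinv x))
    · rw [← hadef]
      field_simp
      ring
  have hright : ∫ x in Set.Ioi r, ψ (FDE A x) ≤
      (-Real.log b + (1 - b) / (2 * b)) * (N (A - 1) * N A⁻¹) := by
    have hk : 0 < b / (1 - b) := div_pos hb0 (by linarith)
    refine (setIntegral_Ioi_le_sub hint
      (fun t ht => hasDerivAt_log_sub_sq ht (b / (1 - b)) (N (A - 1) * N A⁻¹))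
      (fun t ht ht1 => ?_)
      fun x hx => (hpt x).trans (mul_le_mul_of_nonneg_left ?_ (deWeight_pos x).le)).trans_eq ?_
    · have : 0 ≤ 1 - t := by linarith
      positivity
    · rw [mul_assoc]
      refine (hN_mul _ _).trans (mul_le_mul_of_nonneg_left ?_ hβ.le)
      exact le_mul_inv_add_div hc hb0 (hbdef ▸ strictMono_deVar.monotone hx.le) (deVar_lt_one x)
        hbc (norm_inverse_mul_le hN_add hN_smul hN_mul (deVar_pos x).le (deVar_lt_one x).le
          hAinv (hinv x))
    · rw [← hbdef]
      have : 1 - b ≠ 0 := by linarith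
      simp only [Real.log_one, inv_one]
      field_simp
      ring
  linarith
end

section
/- Let n ≥ 1 and let A be an n×n real matrix with A ≠ I whose complex eigenvalues all lie in ℂ∖(−∞,0], and write log(A) = (A−I)∫_0^1 (t(A−I)+I)^{-1} dt. Let ‖·‖₂ denote the spectral norm (the operator norm induced by the Euclidean vector norm). Let θ > 0 be a lower bound on ‖log(A)‖₂, let ε > 0 satisfy ε < 3‖A−I‖₂‖A^{-1}‖₂ / (θ(1+‖A^{-1}‖₂)), and let s ∈ (0,1) satisfy (1/θ)·(−log(s) + (1−s)/(2s))·‖A−I‖₂‖A^{-1}‖₂ = ε/2. Define a := min{ θε/(3‖A−I‖₂), 1/(2‖A−I‖₂) }, b := max{ s, 2‖A^{-1}‖₂/(2‖A^{-1}‖₂+1) }, l := asinh(atanh(2a−1)), and r := asinh(atanh(2b−1)). Then l < r and ‖ log(A) − (A−I)·∫_l^r F_DE(x) dx ‖₂ / ‖log(A)‖₂ ≤ ε. -/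
open MeasureTheory

/-- The spectral norm (operator norm induced by the Euclidean vector norm). -/
noncomputable def specNorm {n : ℕ} (M : Matrix (Fin n) (Fin n) ℝ) : ℝ :=
  ‖Matrix.toEuclideanCLM (𝕜 := ℝ) M‖

/-- Inverse hyperbolic tangent. -/
noncomputable def artanh (x : ℝ) : ℝ := Real.log ((1 + x) / (1 - x)) / 2

section L2Operator

open scoped Matrix.Norms.L2Operator

lemma neg_log_one_sub_le {y : ℝ} (h0 : 0 ≤ y) (h1 : y ≤ 1 / 2) :
    -Real.log (1 - y) ≤ 3 / 2 * y := by
  have h := strictConcaveOn_log_Ioi.concaveOn.2 (Set.mem_Ioi.2 one_pos)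
    (Set.mem_Ioi.2 (one_half_pos (α := ℝ))) (show 0 ≤ 1 - 2 * y by linarith)
    (show 0 ≤ 2 * y by linarith) (by ring)
  simp only [smul_eq_mul, Real.log_one, mul_zero, zero_add, one_div, Real.log_inv] at h
  rw [show (1 - 2 * y) * 1 + 2 * y * 2⁻¹ = 1 - y by ring] at h
  nlinarith [Real.log_two_lt_d9]

/-- The truncation bound near the right endpoint. -/
lemma neg_log_div_le {β b : ℝ} (hβ : 0 < β) (hb : b < 1) (hb' : 2 * β / (2 * β + 1) ≤ b) :
    -Real.log ((1 + β) * b - β) / (1 + β) ≤ -Real.log b + (1 - b) / (2 * b) := by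
  have hb0 : 0 < b := lt_of_lt_of_le (by positivity) hb'
  rw [div_le_iff₀ (by positivity)] at hb'
  set u := (1 - b) / b with hu
  have hu0 : 0 < u := div_pos (by linarith) hb0
  have hub : u * b = 1 - b := by rw [hu]; field_simp
  have hβu : β * u ≤ 1 / 2 := by
    rw [hu, ← mul_div_assoc, div_le_iff₀ hb0]; linarith
  have hfac : (1 + β) * b - β = b * (1 - β * u) := by linear_combination β * hub
  have hl := neg_log_one_sub_le (by positivity) hβu
  have hlog : u ≤ -Real.log b + u ^ 2 := by
    have := Real.log_le_sub_one_of_pos hb0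
    nlinarith
  have hhalf : (1 - b) / (2 * b) = u / 2 := by rw [hu]; field_simp
  rw [hfac, Real.log_mul hb0.ne' (by linarith), hhalf, div_le_iff₀ (by positivity)]
  nlinarith [mul_le_mul_of_nonneg_left hlog hβ.le]

lemma tanh_sinh_arsinh_artanh {c : ℝ} (h0 : 0 < c) (h1 : c < 1) :
    (1 + Real.tanh (Real.sinh (Real.arsinh (artanh (2 * c - 1))))) / 2 = c := by
  have h : artanh (2 * c - 1) = Real.artanh (2 * c - 1) := by
    rw [Real.artanh_eq_half_log ⟨by linarith, by linarith⟩, artanh]; ring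
  rw [Real.sinh_arsinh, h, Real.tanh_artanh ⟨by linarith, by linarith⟩]
  ring

lemma arsinh_artanh_lt {c d : ℝ} (h0 : 0 < c) (hcd : c < d) (h1 : d < 1) :
    Real.arsinh (artanh (2 * c - 1)) < Real.arsinh (artanh (2 * d - 1)) := by
  rw [Real.arsinh_lt_arsinh, artanh, artanh]
  have : (1 + (2 * c - 1)) / (1 - (2 * c - 1)) < (1 + (2 * d - 1)) / (1 - (2 * d - 1)) := by
    rw [div_lt_div_iff₀ (by linarith) (by linarith)]; nlinarith
  linarith [Real.log_lt_log (div_pos (by linarith) (by linarith)) this]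

lemma hasDerivAt_tanh_sinh (x : ℝ) :
    HasDerivAt (fun x => (1 + Real.tanh (Real.sinh x)) / 2)
      (1 / 2 * (Real.cosh x * (1 / Real.cosh (Real.sinh x)) ^ 2)) x := by
  have hc := (Real.cosh_pos (Real.sinh x)).ne'
  have h := ((((Real.hasDerivAt_sinh (Real.sinh x)).div (Real.hasDerivAt_cosh (Real.sinh x)) hc).comp x
    (Real.hasDerivAt_sinh x)).const_add 1).div_const 2
  refine (h.congr_deriv ?_).congr_of_eventuallyEq (.of_forall fun y => ?_)
  · have := Real.cosh_sq (Real.sinh x)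
    field_simp
    rw [this]; ring
  · simp [Real.tanh_eq_sinh_div_cosh]

variable {n : ℕ}

lemma entryIntegral_eq {f : ℝ → Matrix (Fin n) (Fin n) ℝ} {a b : ℝ}
    (hf : IntervalIntegrable f volume a b) : entryIntegral f a b = ∫ t in a..b, f t := by
  ext i j
  exact (Matrix.entryLinearMap ℝ ℝ i j).toContinuousLinearMap.intervalIntegral_comp_comm hf

/-- The segment from the identity to a matrix with spectrum off `(-∞, 0]` is invertible. -/
lemma isUnit_det_segment {A : Matrix (Fin n) (Fin n) ℝ}
    (hspec : ∀ μ ∈ spectrum ℂ (A.map fun x => (x : ℂ)), ¬(μ.im = 0 ∧ μ.re ≤ 0))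
    {t : ℝ} (ht : t ∈ Set.Icc (0 : ℝ) 1) : IsUnit (t • (A - 1) + 1).det := by
  rcases ht.1.eq_or_lt with rfl | ht0
  · simp
  rw [isUnit_iff_ne_zero]
  intro h0
  have hμ : ((-(1 - t) / t : ℝ) : ℂ) ∈ spectrum ℂ (A.map fun x => (x : ℂ)) := by
    rw [Matrix.mem_spectrum_iff_isRoot_charpoly]
    have hmap : (A.map fun x => (x : ℂ)).charpoly = A.charpoly.map Complex.ofRealHom :=
      Matrix.charpoly_map A Complex.ofRealHom
    rw [hmap]
    refine Polynomial.IsRoot.map (f := Complex.ofRealHom) (x := -(1 - t) / t) ?_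
    rw [Polynomial.IsRoot, Matrix.eval_charpoly]
    have : t • (A - 1) + 1 = (-t) • (Matrix.scalar (Fin n) (-(1 - t) / t) - A) := by
      have h1 : Matrix.scalar (Fin n) (-(1 - t) / t) = (-(1 - t) / t) • 1 := by
        simp [Matrix.smul_one_eq_diagonal]
      rw [h1, smul_sub (-t), smul_smul, show -t * (-(1 - t) / t) = 1 - t by field_simp]
      module
    rw [this, Matrix.det_smul] at h0
    exact (mul_eq_zero.1 h0).resolve_left (pow_ne_zero _ (by linarith))
  refine hspec _ hμ ⟨Complex.ofReal_im _, ?_⟩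
  rw [Complex.ofReal_re]
  exact div_nonpos_of_nonpos_of_nonneg (by linarith [ht.2]) ht0.le

lemma continuousOn_inv_segment {A : Matrix (Fin n) (Fin n) ℝ} {S : Set ℝ}
    (h : ∀ t ∈ S, IsUnit (t • (A - 1) + 1).det) :
    ContinuousOn (fun t : ℝ => (t • (A - 1) + 1)⁻¹) S := by
  intro t ht
  have h1 : ContinuousAt Inv.inv (t • (A - 1) + 1) := by
    apply continuousAt_matrix_inv
    obtain ⟨u, hu⟩ := h t ht
    rw [← hu]
    exact NormedRing.inverse_continuousAt u
  have h2 : ContinuousAt (fun t : ℝ => t • (A - 1) + 1) t := by fun_prop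
  exact (ContinuousAt.comp (f := fun t : ℝ => t • (A - 1) + 1) h1 h2).continuousWithinAt

lemma norm_inv_le_left [NeZero n] {M : Matrix (Fin n) (Fin n) ℝ} {t : ℝ} (ht : 0 ≤ t)
    (hu : IsUnit (t • M + 1).det) (h : t * ‖M‖ < 1) :
    ‖(t • M + 1)⁻¹‖ ≤ 1 / (1 - t * ‖M‖) := by
  have key := Matrix.mul_nonsing_inv _ hu
  set Y := (t • M + 1)⁻¹
  have hY : Y = 1 - t • (M * Y) := by
    rw [add_mul, one_mul, smul_mul_assoc] at key
    rw [← key]; abel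
  rw [le_div_iff₀ (by linarith)]
  have h1 : ‖Y‖ ≤ ‖(1 : Matrix (Fin n) (Fin n) ℝ)‖ + ‖t • (M * Y)‖ := by
    conv_lhs => rw [hY]
    exact norm_sub_le _ _
  have h2 : ‖t • (M * Y)‖ ≤ t * (‖M‖ * ‖Y‖) := by
    rw [norm_smul, Real.norm_of_nonneg ht]
    gcongr
    exact norm_mul_le _ _
  rw [CStarRing.norm_one] at h1
  linarith

lemma norm_inv_le_right {A : Matrix (Fin n) (Fin n) ℝ} (hA : IsUnit A.det) {t : ℝ}
    (ht : t ∈ Set.Icc (0 : ℝ) 1) (hu : IsUnit (t • (A - 1) + 1).det)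
    (h : 0 < (1 + ‖A⁻¹‖) * t - ‖A⁻¹‖) :
    ‖(t • (A - 1) + 1)⁻¹‖ ≤ ‖A⁻¹‖ / ((1 + ‖A⁻¹‖) * t - ‖A⁻¹‖) := by
  have key := Matrix.mul_nonsing_inv _ hu
  set Y := (t • (A - 1) + 1)⁻¹
  have hY : t • Y = A⁻¹ - (1 - t) • (A⁻¹ * Y) := by
    have h3 : t • (A⁻¹ * A) * Y + (1 - t) • (A⁻¹ * Y) = A⁻¹ * ((t • (A - 1) + 1) * Y) := by
      rw [← mul_assoc, mul_add, mul_smul_comm, mul_sub, mul_one, smul_mul_assoc, add_mul,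
        smul_mul_assoc, sub_mul]
      module
    rw [Matrix.nonsing_inv_mul _ hA, key, mul_one, smul_mul_assoc, one_mul] at h3
    exact eq_sub_of_add_eq h3
  rw [le_div_iff₀ h]
  have h1 : ‖t • Y‖ ≤ ‖A⁻¹‖ + ‖(1 - t) • (A⁻¹ * Y)‖ := by
    rw [hY]; exact norm_sub_le _ _
  have h2 : ‖(1 - t) • (A⁻¹ * Y)‖ ≤ (1 - t) * (‖A⁻¹‖ * ‖Y‖) := by
    rw [norm_smul, Real.norm_of_nonneg (by linarith [ht.2])]
    gcongr
    · linarith [ht.2]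
    · exact norm_mul_le _ _
  rw [norm_smul, Real.norm_of_nonneg ht.1] at h1
  linarith

lemma norm_integral_left_le [NeZero n] {M : Matrix (Fin n) (Fin n) ℝ} {a : ℝ} (ha : 0 ≤ a)
    (hM : 0 < ‖M‖) (haM : a * ‖M‖ ≤ 1 / 2)
    (hu : ∀ t ∈ Set.Icc 0 a, IsUnit (t • M + 1).det) :
    ‖∫ t in (0 : ℝ)..a, (t • M + 1)⁻¹‖ ≤ 3 / 2 * a := by
  have hlt : ∀ t ∈ Set.Icc 0 a, t * ‖M‖ ≤ 1 / 2 := fun t ht =>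
    (mul_le_mul_of_nonneg_right ht.2 hM.le).trans haM
  have hint : IntervalIntegrable (fun t => 1 / (1 - t * ‖M‖)) volume 0 a := by
    apply ContinuousOn.intervalIntegrable_of_Icc ha
    exact continuousOn_const.div (by fun_prop) fun t ht => by linarith [hlt t ht]
  calc _ ≤ ∫ t in (0 : ℝ)..a, 1 / (1 - t * ‖M‖) := by
        refine intervalIntegral.norm_integral_le_of_norm_le ha (.of_forall fun t ht => ?_) hint
        have ht' := Set.Ioc_subset_Icc_self ht
        exact norm_inv_le_left ht.1.le (hu t ht') (by linarith [hlt t ht'])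
    _ = -Real.log (1 - a * ‖M‖) / ‖M‖ - -Real.log (1 - 0 * ‖M‖) / ‖M‖ := by
        refine intervalIntegral.integral_eq_sub_of_hasDerivAt
          (f := fun t => -Real.log (1 - t * ‖M‖) / ‖M‖) (fun t ht => ?_) hint
        rw [Set.uIcc_of_le ha] at ht
        have hne : 1 - t * ‖M‖ ≠ 0 := by linarith [hlt t ht]
        refine (((((hasDerivAt_id t).mul_const ‖M‖).const_sub 1).log hne).neg.div_const
          ‖M‖).congr_deriv ?_
        simp only [id]
        field_simp
    _ ≤ 3 / 2 * a := by
        have := neg_log_one_sub_le (by positivity) haM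
        rw [zero_mul, sub_zero, Real.log_one, neg_zero, zero_div, sub_zero, div_le_iff₀ hM]
        linarith

lemma norm_integral_right_le {A : Matrix (Fin n) (Fin n) ℝ} (hA : IsUnit A.det) {b : ℝ}
    (hβ : 0 < ‖A⁻¹‖) (hb : 2 * ‖A⁻¹‖ / (2 * ‖A⁻¹‖ + 1) ≤ b) (hb1 : b < 1)
    (hu : ∀ t ∈ Set.Icc b 1, IsUnit (t • (A - 1) + 1).det) :
    ‖∫ t in b..1, (t • (A - 1) + 1)⁻¹‖ ≤ ‖A⁻¹‖ * (-Real.log b + (1 - b) / (2 * b)) := by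
  set β := ‖A⁻¹‖ with hβdef
  have hb0 : 0 < b := lt_of_lt_of_le (by positivity) hb
  have hpos : ∀ t ∈ Set.Icc b 1, 0 < (1 + β) * t - β := fun t ht => by
    have := (div_le_iff₀ (by positivity)).1 (hb.trans ht.1)
    nlinarith [ht.1, ht.2]
  have hint : IntervalIntegrable (fun t => β / ((1 + β) * t - β)) volume b 1 := by
    apply ContinuousOn.intervalIntegrable_of_Icc hb1.le
    exact continuousOn_const.div (by fun_prop) fun t ht => (hpos t ht).ne'
  calc _ ≤ ∫ t in b..1, β / ((1 + β) * t - β) := by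
        refine intervalIntegral.norm_integral_le_of_norm_le hb1.le (.of_forall fun t ht => ?_) hint
        have ht' := Set.Ioc_subset_Icc_self ht
        exact norm_inv_le_right hA ⟨hb0.le.trans ht'.1, ht'.2⟩ (hu t ht') (hpos t ht')
    _ = β * (Real.log ((1 + β) * 1 - β) / (1 + β)) -
          β * (Real.log ((1 + β) * b - β) / (1 + β)) := by
        refine intervalIntegral.integral_eq_sub_of_hasDerivAt
          (f := fun t => β * (Real.log ((1 + β) * t - β) / (1 + β))) (fun t ht => ?_) hint
        rw [Set.uIcc_of_le hb1.le] at ht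
        have hne := (hpos t ht).ne'
        refine ((((((hasDerivAt_id t).const_mul (1 + β)).sub_const β).log hne).div_const
          (1 + β)).const_mul β).congr_deriv ?_
        simp only [id]
        field_simp
    _ = β * (-Real.log ((1 + β) * b - β) / (1 + β)) := by
        rw [show (1 + β) * 1 - β = 1 by ring, Real.log_one]; ring
    _ ≤ _ := by
        gcongr
        exact neg_log_div_le hβ hb1 hb

lemma entryIntegral_FDE {A : Matrix (Fin n) (Fin n) ℝ}
    (hu : ∀ t ∈ Set.Icc (0 : ℝ) 1, IsUnit (t • (A - 1) + 1).det) (l r : ℝ) :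
    entryIntegral (FDE A) l r =
      ∫ t in (1 + Real.tanh (Real.sinh l)) / 2..(1 + Real.tanh (Real.sinh r)) / 2,
        (t • (A - 1) + 1)⁻¹ := by
  set φ : ℝ → ℝ := fun x => (1 + Real.tanh (Real.sinh x)) / 2 with hφ
  set φ' : ℝ → ℝ := fun x => 1 / 2 * (Real.cosh x * (1 / Real.cosh (Real.sinh x)) ^ 2) with hφ'
  have hmem : ∀ x, φ x ∈ Set.Icc (0 : ℝ) 1 := fun x => by
    have h1 := Real.tanh_lt_one (Real.sinh x)
    have h2 := Real.neg_one_lt_tanh (Real.sinh x)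
    constructor <;> simp only [hφ] <;> linarith
  have hF : FDE A = fun x => φ' x • ((φ x) • (A - 1) + 1)⁻¹ := by
    ext1 x
    have h2 : (1 + Real.tanh (Real.sinh x)) • (A - 1) + (2 : Matrix (Fin n) (Fin n) ℝ) =
        (2 : ℝ) • (φ x • (A - 1) + 1) := by
      have : (2 : Matrix (Fin n) (Fin n) ℝ) = (2 : ℝ) • 1 := by
        rw [two_smul, one_add_one_eq_two]
      rw [this, smul_add, smul_smul, hφ]
      congr 2
      ring
    let _ : Invertible (2 : ℝ) := invertibleOfNonzero two_ne_zero
    rw [FDE, h2, Matrix.inv_smul _ _ (hu _ (hmem x)), smul_smul, invOf_eq_inv]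
    congr 1
    simp only [hφ']
    ring
  have hφd : ∀ x, HasDerivAt φ (φ' x) x := hasDerivAt_tanh_sinh
  have hφ'c : Continuous φ' := by
    have : ∀ x, Real.cosh (Real.sinh x) ≠ 0 := fun x => (Real.cosh_pos _).ne'
    fun_prop (disch := assumption)
  have hφc : Continuous φ := continuous_iff_continuousAt.2 fun x => (hφd x).continuousAt
  have hg := continuousOn_inv_segment hu
  have hcont : Continuous (FDE A) := by
    rw [hF]
    exact hφ'c.smul (hg.comp_continuous hφc hmem)
  rw [entryIntegral_eq (hcont.intervalIntegrable l r), hF]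
  exact intervalIntegral.integral_deriv_smul_comp' (fun x _ => hφd x) hφ'c.continuousOn
    (hg.mono (Set.image_subset_iff.2 fun x _ => hmem x))

/-- Truncating the integral representation of the logarithm to `[a, b]`. -/
lemma norm_log_sub_truncation_le [NeZero n] {A : Matrix (Fin n) (Fin n) ℝ}
    (hu : ∀ t ∈ Set.Icc (0 : ℝ) 1, IsUnit (t • (A - 1) + 1).det) {a b : ℝ} (ha : 0 ≤ a)
    (hab : a < b) (hb1 : b < 1) (hM : 0 < ‖A - 1‖) (haM : a * ‖A - 1‖ ≤ 1 / 2)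
    (hβ : 0 < ‖A⁻¹‖) (hb : 2 * ‖A⁻¹‖ / (2 * ‖A⁻¹‖ + 1) ≤ b) :
    ‖(A - 1) * entryIntegral (fun t => (t • (A - 1) + 1)⁻¹) 0 1 -
        (A - 1) * ∫ t in a..b, (t • (A - 1) + 1)⁻¹‖ ≤
      ‖A - 1‖ * (3 / 2 * a + ‖A⁻¹‖ * (-Real.log b + (1 - b) / (2 * b))) := by
  have hint : ∀ x ∈ Set.Icc (0 : ℝ) 1, ∀ y ∈ Set.Icc (0 : ℝ) 1,
      IntervalIntegrable (fun t : ℝ => (t • (A - 1) + 1)⁻¹) volume x y := fun x hx y hy =>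
    ((continuousOn_inv_segment hu).mono (Set.uIcc_subset_Icc hx hy)).intervalIntegrable
  have h0 : (0 : ℝ) ∈ Set.Icc (0 : ℝ) 1 := by simp
  have h1 : (1 : ℝ) ∈ Set.Icc (0 : ℝ) 1 := by simp
  have ha' : a ∈ Set.Icc (0 : ℝ) 1 := ⟨ha, by linarith⟩
  have hb' : b ∈ Set.Icc (0 : ℝ) 1 := ⟨by linarith, hb1.le⟩
  have hA : IsUnit A.det := by simpa using hu 1 h1
  rw [entryIntegral_eq (hint 0 h0 1 h1),
    ← intervalIntegral.integral_add_adjacent_intervals (hint 0 h0 b hb') (hint b hb' 1 h1),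
    ← intervalIntegral.integral_add_adjacent_intervals (hint 0 h0 a ha') (hint a ha' b hb'),
    ← mul_sub, add_right_comm, add_sub_cancel_right]
  refine (norm_mul_le _ _).trans ?_
  gcongr
  refine (norm_add_le _ _).trans (add_le_add ?_ ?_)
  · exact norm_integral_left_le ha hM haM fun t ht => hu t ⟨ht.1, ht.2.trans ha'.2⟩
  · exact norm_integral_right_le hA hβ hb hb1 fun t ht => hu t ⟨hb'.1.trans ht.1, ht.2⟩

end L2Operator

/-- Proposition 2.5: the interval selection guarantees relative truncation error at most `ε`. -/
theorem stmt_8 {n : ℕ} (hn : 1 ≤ n) (A : Matrix (Fin n) (Fin n) ℝ) (hA : A ≠ 1)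
    (hspec : ∀ μ ∈ spectrum ℂ (A.map fun x => (x : ℂ)), ¬(μ.im = 0 ∧ μ.re ≤ 0))
    (logA : Matrix (Fin n) (Fin n) ℝ)
    (hlogA : logA = (A - 1) * entryIntegral (fun t => (t • (A - 1) + 1)⁻¹) 0 1)
    (θ : ℝ) (hθ0 : 0 < θ) (hθ : θ ≤ specNorm logA)
    (ε : ℝ) (hε0 : 0 < ε)
    (hε : ε < 3 * specNorm (A - 1) * specNorm A⁻¹ / (θ * (1 + specNorm A⁻¹)))
    (s : ℝ) (hs : s ∈ Set.Ioo (0 : ℝ) 1)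
    (hseq : (1 / θ) * (-Real.log s + (1 - s) / (2 * s)) *
        (specNorm (A - 1) * specNorm A⁻¹) = ε / 2)
    (a b l r : ℝ)
    (hadef : a = min (θ * ε / (3 * specNorm (A - 1))) (1 / (2 * specNorm (A - 1))))
    (hbdef : b = max s (2 * specNorm A⁻¹ / (2 * specNorm A⁻¹ + 1)))
    (hldef : l = Real.arsinh (artanh (2 * a - 1)))
    (hrdef : r = Real.arsinh (artanh (2 * b - 1))) :
    l < r ∧
      specNorm (logA - (A - 1) * entryIntegral (FDE A) l r) / specNorm logA ≤ ε := by
  have : NeZero n := ⟨by omega⟩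
  have hu : ∀ t ∈ Set.Icc (0 : ℝ) 1, IsUnit (t • (A - 1) + 1).det := fun t ht =>
    isUnit_det_segment hspec ht
  have hM : 0 < specNorm (A - 1) :=
    norm_pos_iff.2 <| (map_ne_zero_iff _ (EquivLike.injective _)).2 (sub_ne_zero.2 hA)
  have hβ : 0 < specNorm A⁻¹ := by
    have hdet : IsUnit A.det := by simpa using hu 1 (by simp)
    refine norm_pos_iff.2 <| (map_ne_zero_iff _ (EquivLike.injective _)).2 fun h => ?_
    have := Matrix.nonsing_inv_mul A hdet
    rw [h, zero_mul] at this
    exact zero_ne_one this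
  have htrunc := norm_log_sub_truncation_le hu (a := a) (b := b)
  change _ → _ → _ → 0 < specNorm (A - 1) → a * specNorm (A - 1) ≤ _ → 0 < specNorm A⁻¹ →
    2 * specNorm A⁻¹ / (2 * specNorm A⁻¹ + 1) ≤ b → specNorm _ ≤ specNorm (A - 1) *
      (3 / 2 * a + specNorm A⁻¹ * (-Real.log b + (1 - b) / (2 * b))) at htrunc
  rw [← hlogA] at htrunc
  generalize specNorm (A - 1) = α at *
  generalize specNorm A⁻¹ = β at *
  have hs0 : 0 < s := hs.1
  have ha0 : 0 < a := by rw [hadef]; positivity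
  have hsb : s ≤ b := hbdef ▸ le_max_left _ _
  have hβb : 2 * β / (2 * β + 1) ≤ b := hbdef ▸ le_max_right _ _
  have hb0 : 0 < b := hs0.trans_le hsb
  have hb1 : b < 1 := by
    rw [hbdef]
    exact max_lt hs.2 (by rw [div_lt_one (by positivity)]; linarith)
  have haε : a ≤ θ * ε / (3 * α) := hadef ▸ min_le_left _ _
  have haα : a * α ≤ 1 / 2 := by
    have : a ≤ 1 / (2 * α) := hadef ▸ min_le_right _ _
    rw [le_div_iff₀ (by positivity)] at this
    linarith
  have hab : a < b := by
    refine haε.trans_lt (lt_of_lt_of_le ?_ hβb)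
    rw [lt_div_iff₀ (by positivity)] at hε
    rw [div_lt_div_iff₀ (by positivity) (by positivity)]
    nlinarith [mul_pos (mul_pos hθ0 hε0) hβ, mul_pos hM hβ]
  refine ⟨hldef ▸ hrdef ▸ arsinh_artanh_lt ha0 hab hb1, ?_⟩
  rw [entryIntegral_FDE hu, hldef, hrdef, tanh_sinh_arsinh_artanh ha0 (hab.trans hb1),
    tanh_sinh_arsinh_artanh hb0 hb1, div_le_iff₀ (hθ0.trans_le hθ)]
  refine (htrunc ha0.le hab hb1 hM haα hβ hβb).trans ?_
  have hleft : 3 / 2 * (a * α) ≤ θ * ε / 2 := by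
    rw [le_div_iff₀ (by positivity)] at haε
    linarith
  have hright : α * β * (-Real.log b + (1 - b) / (2 * b)) ≤ θ * ε / 2 := by
    calc _ ≤ α * β * (-Real.log s + (1 - s) / (2 * s)) := by
          have h1 : Real.log s ≤ Real.log b := Real.log_le_log hs0 hsb
          have h2 : (1 - b) / (2 * b) ≤ (1 - s) / (2 * s) := by
            rw [div_le_div_iff₀ (by positivity) (by positivity)]
            nlinarith
          gcongr
      _ = θ * (1 / θ * (-Real.log s + (1 - s) / (2 * s)) * (α * β)) := by field_simp
      _ = θ * ε / 2 := by rw [hseq]; ring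
  nlinarith [mul_le_mul_of_nonneg_right hθ hε0.le]
end
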